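/- arXiv:1512.01638 — 2 statements merged into one kernel-verified Lean document; each statement's English description precedes it below -/
import Mathlib

section
/- Let γ ∈ [−3,−2), let p satisfy 3/(3+γ+2) < p ≤ ∞, and let θ > 2 + 3(1−1/p). Then there exists a constant C > 0 such that for every measurable f : ℝ³ → ℝ with ‖⟨·⟩^θ f‖_{L^p(ℝ³)} < ∞, the convolution integrals (a_{ij}*f)(v) = ∫_{ℝ³} a_{ij}(v−v_*) f(v_*) dv_* converge absolutely for every v, and for all v ∈ ℝ³: |Σ_{i,j} (a_{ij}*f)(v) v_i v_j| ≤ C ⟨v⟩^{γ+2} ‖⟨·⟩^θ f‖_{L^p}, for each i, |Σ_j (a_{ij}*f)(v) v_j| ≤ C ⟨v⟩^{γ+2} ‖⟨·⟩^θ f‖_{L^p}, and for each i,j, |(a_{ij}*f)(v)| ≤ C ⟨v⟩^{γ+2} ‖⟨·⟩^θ f‖_{L^p}. -/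
noncomputable section

open MeasureTheory Real Filter

abbrev V3 := EuclideanSpace ℝ (Fin 3)

/-- Japanese bracket ⟨v⟩ = (1+|v|²)^{1/2}. -/
def jap (v : V3) : ℝ := Real.sqrt (1 + ‖v‖ ^ 2)

/-- Standard Gaussian μ on ℝ³. -/
def gaussM (v : V3) : ℝ := (2 * Real.pi) ^ (-(3 : ℝ) / 2) * Real.exp (-‖v‖ ^ 2 / 2)

/-- Landau kernel matrix a_{ij}(z). -/
def aker (γ : ℝ) (z : V3) (i j : Fin 3) : ℝ :=
  ‖z‖ ^ (γ + 2) * ((if i = j then (1 : ℝ) else 0) - z i * z j / ‖z‖ ^ 2)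

/-- ā_{ij} = a_{ij} * μ. -/
def abar (γ : ℝ) (v : V3) (i j : Fin 3) : ℝ := ∫ w : V3, aker γ (v - w) i j * gaussM w

def bker (γ : ℝ) (z : V3) (i : Fin 3) : ℝ := -2 * ‖z‖ ^ γ * z i

/-- b̄_i = b_i * μ. -/
def bbar (γ : ℝ) (v : V3) (i : Fin 3) : ℝ := ∫ w : V3, bker γ (v - w) i * gaussM w

/-- J_β(v) = ∫ |v−w|^β μ(w) dw. -/
def Jfun (β : ℝ) (v : V3) : ℝ := ∫ w : V3, ‖v - w‖ ^ β * gaussM w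

/-- c̄(v) = −2(γ+3) J_γ(v). -/
def cbar (γ : ℝ) (v : V3) : ℝ := -2 * (γ + 3) * Jfun γ v

/-- ℓ₁(v). -/
def ell1 (γ : ℝ) (v : V3) : ℝ :=
  ∫ w : V3, (1 - ((∑ i, v i * w i) / (‖v‖ * ‖w‖)) ^ 2) * ‖w‖ ^ (γ + 2) * gaussM (v - w)

/-- Squared Euclidean norm of the cross product of two vectors in ℝ³. -/
def crossSq (a b : V3) : ℝ :=
  ∑ i, (crossProduct (R := ℝ) (fun k => a k) (fun k => b k) i) ^ 2

/-- ℓ₂(v). -/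
def ell2 (γ : ℝ) (v : V3) : ℝ :=
  ∫ w : V3,
    (1 - (1 / 2) * crossSq (‖v‖⁻¹ • v) (‖w‖⁻¹ • w)) * ‖w‖ ^ (γ + 2) * gaussM (v - w)

/-- Projection P_v ξ on the direction v. -/
def Pv (v ξ : V3) : V3 := ((∑ i, ξ i * v i) / ‖v‖ ^ 2) • v

/-- Partial derivative in the i-th coordinate direction. -/
def pd (i : Fin 3) (f : V3 → ℝ) : V3 → ℝ := fun v => fderiv ℝ f v (EuclideanSpace.single i 1)

/-- Anisotropic gradient ∇̃f = P_v ∇f + ⟨v⟩ (I − P_v) ∇f. -/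
def anisoGrad (f : V3 → ℝ) (v : V3) : V3 :=
  Pv v (gradient f v) + jap v • (gradient f v - Pv v (gradient f v))

/-- The filter |v| → ∞ on ℝ³. -/
def normAtTop : Filter V3 := Filter.comap (fun v : V3 => ‖v‖) Filter.atTop

/-- Convolution on ℝ³. -/
def conv3 (f g : V3 → ℝ) (v : V3) : ℝ := ∫ w : V3, f (v - w) * g w

lemma jap_pos (v : V3) : 0 < jap v := Real.sqrt_pos.2 (by positivity)

lemma jap_sq (v : V3) : jap v ^ 2 = 1 + ‖v‖ ^ 2 := Real.sq_sqrt (by positivity)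

lemma one_le_jap (v : V3) : 1 ≤ jap v := by
  have := jap_sq v
  nlinarith [jap_pos v, sq_nonneg ‖v‖]

lemma norm_le_jap (v : V3) : ‖v‖ ≤ jap v := by
  have := jap_sq v
  exact abs_le_of_sq_le_sq' (by linarith) (jap_pos v).le |>.2

lemma jap_le_one_add_norm (v : V3) : jap v ≤ 1 + ‖v‖ := by
  have := jap_sq v
  have h := norm_nonneg v
  exact abs_le_of_sq_le_sq' (by nlinarith) (by linarith) |>.2

lemma jap_add_le (w z : V3) : jap (w + z) ≤ jap w + ‖z‖ := by
  have h1 := jap_sq w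
  have h2 := jap_sq (w + z)
  have h3 := norm_add_le w z
  have h4 := norm_le_jap w
  have h5 := norm_nonneg z
  have h6 := norm_nonneg (w + z)
  have h7 : ‖w + z‖ ^ 2 ≤ (‖w‖ + ‖z‖) ^ 2 := pow_le_pow_left₀ h6 h3 2
  have h8 := mul_le_mul_of_nonneg_right h4 h5
  exact abs_le_of_sq_le_sq' (by nlinarith) (by linarith [jap_pos w]) |>.2

lemma continuous_jap : Continuous jap := by
  unfold jap
  fun_prop

lemma measurable_norm_rpow_mul_jap_rpow (a b : ℝ) (v : V3) :
    Measurable (fun w : V3 => ‖v - w‖ ^ a * jap w ^ b) := by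
  have := continuous_jap.measurable
  fun_prop

lemma integrable_jap_rpow_neg {m : ℝ} (hm : 3 < m) :
    Integrable (fun w : V3 => jap w ^ (-m)) := by
  have h := integrable_rpow_neg_one_add_norm_sq (E := V3) (μ := volume) (r := m)
    (by simpa using hm)
  refine h.congr (Eventually.of_forall fun w => ?_)
  change _ = (Real.sqrt (1 + ‖w‖ ^ 2)) ^ (-m)
  rw [Real.sqrt_eq_rpow, ← Real.rpow_mul (by positivity)]
  ring_nf

lemma integrable_norm_rpow_neg_mul_jap_rpow {a m : ℝ} (ha : 0 ≤ a) (ha3 : a < 3) (hm : 3 < m) :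
    Integrable (fun z : V3 => ‖z‖ ^ (-a) * jap z ^ (a - m)) := by
  have hmeas : Measurable (fun z : V3 => ‖z‖ ^ (-a) * jap z ^ (a - m)) := by
    have := continuous_jap.measurable
    fun_prop
  have hin : IntegrableOn (fun z : V3 => ‖z‖ ^ (-a) * jap z ^ (a - m)) (Metric.ball 0 1) := by
    refine integrableOn_ball_of_norm_le_rpow (C := 1) (α := a) (by simp) (by simpa using ha3)
      (Eventually.of_forall fun z => ?_) hmeas.aestronglyMeasurable
    have h1 : jap z ^ (a - m) ≤ 1 :=
      Real.rpow_le_one_of_one_le_of_nonpos (one_le_jap z) (by linarith)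
    have h2 : 0 ≤ ‖z‖ ^ (-a) := by positivity
    have h3 : 0 ≤ jap z ^ (a - m) := Real.rpow_nonneg (jap_pos z).le _
    rw [Real.norm_of_nonneg (mul_nonneg h2 h3), one_mul]
    exact mul_le_of_le_one_right h2 h1
  have hout : IntegrableOn (fun z : V3 => ‖z‖ ^ (-a) * jap z ^ (a - m)) (Metric.ball 0 1)ᶜ := by
    refine Integrable.mono' (((integrable_jap_rpow_neg hm).const_mul (2 ^ a)).integrableOn)
      hmeas.aestronglyMeasurable ?_
    refine (ae_restrict_iff' measurableSet_ball.compl).2 (Eventually.of_forall fun z hz => ?_)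
    have hz1 : 1 ≤ ‖z‖ := by simpa using hz
    have h1 : jap z / 2 ≤ ‖z‖ := by linarith [jap_le_one_add_norm z]
    have h3 : 0 < jap z := jap_pos z
    rw [Real.norm_of_nonneg (by positivity)]
    calc ‖z‖ ^ (-a) * jap z ^ (a - m) ≤ (jap z / 2) ^ (-a) * jap z ^ (a - m) := by
          gcongr ?_ * _
          exact Real.rpow_le_rpow_of_nonpos (by positivity) h1 (by linarith)
      _ = 2 ^ a * jap z ^ (-m) := by
          rw [Real.div_rpow h3.le (by norm_num), Real.rpow_neg (by norm_num : (0 : ℝ) ≤ 2),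
            show -m = -a + (a - m) by ring, Real.rpow_add h3]
          field_simp
  simpa using hin.union hout

lemma norm_rpow_neg_mul_jap_rpow_neg_le {a m : ℝ} (ha : 0 ≤ a) (ham : a ≤ m) (v w : V3) :
    ‖v - w‖ ^ (-a) * jap w ^ (-m) ≤
      (2 ^ a * jap w ^ (-m) + 2 ^ m * 2 ^ (m - a) * (‖v - w‖ ^ (-a) * jap (v - w) ^ (a - m)))
        * jap v ^ (-a) := by
  have hv := jap_pos v
  have hw := jap_pos w
  have hz := jap_pos (v - w)
  have two_half : ∀ {x : ℝ}, 0 < x → ∀ b : ℝ, (x / 2) ^ (-b) = 2 ^ b * x ^ (-b) := by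
    intro x hx b
    rw [Real.div_rpow hx.le (by norm_num), Real.rpow_neg (by norm_num : (0 : ℝ) ≤ 2)]
    field_simp
  rcases le_or_gt (jap v / 2) ‖v - w‖ with h | h
  · have h1 : ‖v - w‖ ^ (-a) ≤ 2 ^ a * jap v ^ (-a) := by
      rw [← two_half hv]
      exact Real.rpow_le_rpow_of_nonpos (by positivity) h (by linarith)
    calc ‖v - w‖ ^ (-a) * jap w ^ (-m) ≤ 2 ^ a * jap v ^ (-a) * jap w ^ (-m) := by gcongr
      _ = (2 ^ a * jap w ^ (-m) + 0) * jap v ^ (-a) := by ring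
      _ ≤ _ := by
        gcongr
        positivity
  · have h1 : jap v / 2 ≤ jap w := by
      have := jap_add_le w (v - w)
      rw [add_sub_cancel] at this
      linarith
    have h2 : jap (v - w) / 2 ≤ jap v := by
      linarith [jap_le_one_add_norm (v - w), one_le_jap v]
    have h3 : jap w ^ (-m) ≤ 2 ^ m * jap v ^ (-m) := by
      rw [← two_half hv]
      exact Real.rpow_le_rpow_of_nonpos (by positivity) h1 (by linarith)
    have h4 : jap v ^ (a - m) ≤ 2 ^ (m - a) * jap (v - w) ^ (a - m) := by
      rw [← neg_sub m a, ← two_half hz]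
      exact Real.rpow_le_rpow_of_nonpos (by positivity) h2 (by linarith)
    calc ‖v - w‖ ^ (-a) * jap w ^ (-m) ≤ ‖v - w‖ ^ (-a) * (2 ^ m * jap v ^ (-m)) := by gcongr
      _ = ‖v - w‖ ^ (-a) * (2 ^ m * (jap v ^ (-a) * jap v ^ (a - m))) := by
        rw [← Real.rpow_add hv]
        congr 4
        ring
      _ ≤ ‖v - w‖ ^ (-a) * (2 ^ m * (jap v ^ (-a) *
            (2 ^ (m - a) * jap (v - w) ^ (a - m)))) := by gcongr
      _ = (0 + 2 ^ m * 2 ^ (m - a) * (‖v - w‖ ^ (-a) * jap (v - w) ^ (a - m)))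
            * jap v ^ (-a) := by ring
      _ ≤ _ := by
        gcongr
        positivity

/-- Convolving an integrable power of the Japanese bracket with a locally integrable
homogeneous kernel preserves the decay of the kernel. -/
lemma exists_integral_norm_rpow_neg_mul_jap_rpow_neg_le {a m : ℝ} (ha : 0 ≤ a) (ha3 : a < 3)
    (hm : 3 < m) :
    ∃ M > (0 : ℝ), ∀ v : V3, Integrable (fun w : V3 => ‖v - w‖ ^ (-a) * jap w ^ (-m)) ∧
      ∫ w : V3, ‖v - w‖ ^ (-a) * jap w ^ (-m) ≤ M * jap v ^ (-a) := by
  set H : V3 → ℝ := fun z => ‖z‖ ^ (-a) * jap z ^ (a - m) with hH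
  have hHi : Integrable H := integrable_norm_rpow_neg_mul_jap_rpow ha ha3 hm
  have hJ := integrable_jap_rpow_neg hm
  have hH0 : 0 ≤ ∫ z, H z := integral_nonneg fun z =>
    mul_nonneg (by positivity) (Real.rpow_nonneg (jap_pos z).le _)
  have hJ0 : 0 ≤ ∫ z : V3, jap z ^ (-m) := integral_nonneg fun z =>
    Real.rpow_nonneg (jap_pos z).le _
  refine ⟨2 ^ a * (∫ z : V3, jap z ^ (-m)) + 2 ^ m * 2 ^ (m - a) * (∫ z, H z) + 1,
    by positivity, fun v => ?_⟩
  have hb : Integrable (fun w : V3 =>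
      (2 ^ a * jap w ^ (-m) + 2 ^ m * 2 ^ (m - a) * H (v - w)) * jap v ^ (-a)) :=
    ((hJ.const_mul _).add ((hHi.comp_sub_left v).const_mul _)).mul_const _
  have hle := norm_rpow_neg_mul_jap_rpow_neg_le (m := m) ha (by linarith) v
  have hi : Integrable (fun w : V3 => ‖v - w‖ ^ (-a) * jap w ^ (-m)) := by
    refine hb.mono' (measurable_norm_rpow_mul_jap_rpow _ _ v).aestronglyMeasurable
      (Eventually.of_forall fun w => ?_)
    rw [Real.norm_of_nonneg (mul_nonneg (by positivity) (Real.rpow_nonneg (jap_pos w).le _))]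
    exact hle w
  refine ⟨hi, (integral_mono hi hb hle).trans ?_⟩
  rw [integral_mul_const, integral_add (hJ.const_mul _) ((hHi.comp_sub_left v).const_mul _),
    integral_const_mul, integral_const_mul, integral_sub_left_eq_self H]
  have := Real.rpow_nonneg (jap_pos v).le (-a)
  refine mul_le_mul_of_nonneg_right ?_ this
  linarith

/-- Weighted Hölder estimate for the Riesz-type potential of order `s`. -/
lemma exists_integral_norm_rpow_neg_mul_jap_sq_mul_abs_le {s θ : ℝ} {p : ENNReal} (hs : 0 ≤ s)
    (hp1 : 1 < p) (hsp : s < 3 * (1 - p⁻¹.toReal)) (hθ : 2 + 3 * (1 - p⁻¹.toReal) < θ) :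
    ∃ C > (0 : ℝ), ∀ f : V3 → ℝ, Measurable f →
      eLpNorm (fun v => jap v ^ θ * f v) p volume < ⊤ → ∀ v : V3,
        Integrable (fun w : V3 => ‖v - w‖ ^ (-s) * jap w ^ 2 * |f w|) ∧
        ∫ w : V3, ‖v - w‖ ^ (-s) * jap w ^ 2 * |f w| ≤
          C * jap v ^ (-s) * (eLpNorm (fun v => jap v ^ θ * f v) p volume).toReal := by
  have hpi : p⁻¹ < 1 := ENNReal.inv_lt_one.2 hp1
  set q : ENNReal := (1 - p⁻¹)⁻¹ with hq
  have hpq : p.HolderConjugate q := ENNReal.HolderConjugate.inv_one_sub_inv' hp1.le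
  have hqp : q.HolderConjugate p := hpq.symm
  set t : ℝ := 1 - p⁻¹.toReal with ht
  have htpos : 0 < t := by
    have := (ENNReal.toReal_lt_toReal hpi.ne_top ENNReal.one_ne_top).2 hpi
    rw [ENNReal.toReal_one] at this
    linarith
  have hqt : q.toReal = t⁻¹ := by
    rw [hq, ENNReal.toReal_inv, ENNReal.toReal_sub_of_le hpi.le ENNReal.one_ne_top,
      ENNReal.toReal_one]
  have hq0 : q ≠ 0 := by
    rintro h
    rw [h] at hqt
    simp at hqt
    exact htpos.ne' hqt.symm
  have hqtop : q ≠ ⊤ := by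
    rintro h
    rw [h] at hqt
    simp at hqt
    exact htpos.ne' hqt.symm
  obtain ⟨M, hM, hMv⟩ := exists_integral_norm_rpow_neg_mul_jap_rpow_neg_le
    (a := s * t⁻¹) (m := (θ - 2) * t⁻¹) (by positivity)
    (by rw [← div_eq_mul_inv, div_lt_iff₀ htpos]; linarith)
    (by rw [← div_eq_mul_inv, lt_div_iff₀ htpos]; linarith)
  refine ⟨M ^ t, by positivity, fun f hf hfin v => ?_⟩
  set k : V3 → ℝ := fun w => ‖v - w‖ ^ (-s) * jap w ^ (2 - θ) with hk
  set F : V3 → ℝ := fun v => jap v ^ θ * f v with hF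
  have hkm : AEStronglyMeasurable k volume :=
    (measurable_norm_rpow_mul_jap_rpow _ _ v).aestronglyMeasurable
  have hFm : AEStronglyMeasurable F volume := by
    have := continuous_jap.measurable
    exact (by fun_prop : Measurable F).aestronglyMeasurable
  have hkpow : (fun w => ‖k w‖ ^ q.toReal) =
      fun w => ‖v - w‖ ^ (-(s * t⁻¹)) * jap w ^ (-((θ - 2) * t⁻¹)) := by
    funext w
    have h1 : 0 ≤ ‖v - w‖ ^ (-s) := by positivity
    have h2 : 0 ≤ jap w ^ (2 - θ) := Real.rpow_nonneg (jap_pos w).le _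
    rw [hqt, hk, Real.norm_of_nonneg (mul_nonneg h1 h2), Real.mul_rpow h1 h2,
      ← Real.rpow_mul (norm_nonneg _), ← Real.rpow_mul (jap_pos w).le]
    congr 2 <;> ring
  have hkL : MemLp k q volume := by
    rw [← integrable_norm_rpow_iff hkm hq0 hqtop, hkpow]
    exact (hMv v).1
  have hknorm : (eLpNorm k q volume).toReal ≤ M ^ t * jap v ^ (-s) := by
    have hv := jap_pos v
    rw [hkL.eLpNorm_eq_integral_rpow_norm hq0 hqtop, hkpow, hqt, inv_inv,
      ENNReal.toReal_ofReal (Real.rpow_nonneg (integral_nonneg fun w => mul_nonneg (by positivity)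
        (Real.rpow_nonneg (jap_pos w).le _)) _)]
    calc _ ≤ (M * jap v ^ (-(s * t⁻¹))) ^ t :=
          Real.rpow_le_rpow (integral_nonneg fun w => mul_nonneg (by positivity)
            (Real.rpow_nonneg (jap_pos w).le _)) (hMv v).2 htpos.le
      _ = M ^ t * jap v ^ (-s) := by
          rw [Real.mul_rpow hM.le (by positivity), ← Real.rpow_mul hv.le]
          congr 2
          field_simp
  have hFL : MemLp F p volume := ⟨hFm, hfin⟩
  have hkF : Integrable (fun w => k w * F w) := hkL.integrable_mul hFL
  have heq : (fun w : V3 => ‖v - w‖ ^ (-s) * jap w ^ 2 * |f w|) = fun w => ‖k w * F w‖ := by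
    funext w
    have hw := jap_pos w
    have h1 : 0 ≤ ‖v - w‖ ^ (-s) := by positivity
    have h2 : jap w ^ (2 - θ) * jap w ^ θ = jap w ^ 2 := by
      rw [← Real.rpow_add hw, sub_add_cancel, Real.rpow_two]
    rw [Real.norm_eq_abs, hk, hF, abs_mul, abs_mul, abs_mul, abs_of_nonneg h1,
      abs_of_pos (Real.rpow_pos_of_pos hw (2 - θ)), abs_of_pos (Real.rpow_pos_of_pos hw θ), ← h2]
    ring
  rw [heq]
  refine ⟨hkF.norm, ?_⟩
  have hH : eLpNorm (k • F) 1 volume ≤ eLpNorm k q volume * eLpNorm F p volume :=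
    eLpNorm_smul_le_mul_eLpNorm hFm hkm
  rw [eLpNorm_one_eq_lintegral_enorm] at hH
  rw [integral_norm_eq_lintegral_enorm hkF.aestronglyMeasurable]
  calc _ ≤ (eLpNorm k q volume * eLpNorm F p volume).toReal :=
        ENNReal.toReal_mono (ENNReal.mul_ne_top hkL.eLpNorm_ne_top hFL.eLpNorm_ne_top) hH
    _ ≤ _ := by
        rw [ENNReal.toReal_mul]
        gcongr

lemma abs_apply_le_norm (z : V3) (i : Fin 3) : |z i| ≤ ‖z‖ := PiLp.norm_apply_le z i

lemma abs_aker_le (γ : ℝ) (z : V3) (i j : Fin 3) : |aker γ z i j| ≤ 2 * ‖z‖ ^ (γ + 2) := by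
  have h1 : |z i * z j / ‖z‖ ^ 2| ≤ 1 := by
    rw [abs_div, abs_mul, abs_of_nonneg (sq_nonneg ‖z‖)]
    refine div_le_one_of_le₀ ?_ (sq_nonneg _)
    rw [sq]
    exact mul_le_mul (abs_apply_le_norm z i) (abs_apply_le_norm z j) (abs_nonneg _)
      (norm_nonneg _)
  have h2 : |(if i = j then (1 : ℝ) else 0) - z i * z j / ‖z‖ ^ 2| ≤ 2 := by
    refine (abs_sub _ _).trans ?_
    have : |(if i = j then (1 : ℝ) else 0)| ≤ 1 := by split_ifs <;> simp
    linarith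
  have h3 : 0 ≤ ‖z‖ ^ (γ + 2) := by positivity
  rw [aker, abs_mul, abs_of_nonneg h3, mul_comm]
  gcongr

lemma aker_symm (γ : ℝ) (z : V3) (i j : Fin 3) : aker γ z i j = aker γ z j i := by
  simp only [aker, eq_comm (a := i), mul_comm (z i)]

lemma sum_aker_mul_self (γ : ℝ) (z : V3) (i : Fin 3) : ∑ j, aker γ z i j * z j = 0 := by
  rcases eq_or_ne z 0 with rfl | hz
  · simp
  have hz2 : ‖z‖ ^ 2 ≠ 0 := by simpa using hz
  have hn : ∑ j, z j * z j = ‖z‖ ^ 2 := by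
    rw [EuclideanSpace.real_norm_sq_eq]
    simp [sq]
  calc ∑ j, aker γ z i j * z j
      = ‖z‖ ^ (γ + 2) * (z i - z i * (∑ j, z j * z j) / ‖z‖ ^ 2) := by
        simp only [aker, mul_assoc, ← Finset.mul_sum, sub_mul, Finset.sum_sub_distrib]
        congr 2
        · simp
        · rw [Finset.mul_sum, Finset.sum_div]
          exact Finset.sum_congr rfl fun j _ => by ring
    _ = 0 := by
        rw [hn, mul_div_cancel_right₀ _ hz2, sub_self, mul_zero]

lemma sum_aker_sub_mul (γ : ℝ) (v w : V3) (i : Fin 3) :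
    ∑ j, aker γ (v - w) i j * v j = ∑ j, aker γ (v - w) i j * w j := by
  have h := sum_aker_mul_self γ (v - w) i
  simp only [PiLp.sub_apply, mul_sub, Finset.sum_sub_distrib] at h
  linarith

lemma sum_sum_aker_sub_mul_mul (γ : ℝ) (v w : V3) :
    ∑ i, ∑ j, aker γ (v - w) i j * v i * v j = ∑ i, ∑ j, aker γ (v - w) i j * w i * w j := by
  calc ∑ i, ∑ j, aker γ (v - w) i j * v i * v j
      = ∑ i, v i * ∑ j, aker γ (v - w) i j * v j := by
        simp only [Finset.mul_sum]
        exact Finset.sum_congr rfl fun i _ => Finset.sum_congr rfl fun j _ => by ring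
    _ = ∑ i, ∑ j, v i * (aker γ (v - w) i j * w j) :=
        Finset.sum_congr rfl fun i _ => by rw [sum_aker_sub_mul γ v w i, Finset.mul_sum]
    _ = ∑ j, w j * ∑ i, aker γ (v - w) j i * v i := by
        rw [Finset.sum_comm]
        simp only [Finset.mul_sum]
        refine Finset.sum_congr rfl fun j _ => Finset.sum_congr rfl fun i _ => ?_
        rw [aker_symm γ (v - w) i j]
        ring
    _ = _ := by
        refine Finset.sum_congr rfl fun i _ => ?_
        rw [sum_aker_sub_mul γ v w i, Finset.mul_sum]
        exact Finset.sum_congr rfl fun j _ => by ring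

/-- Lemma 4.2 (i): weighted L^p bounds on a_{ij} * f. -/
theorem stmt15 (γ : ℝ) (hγ : γ ∈ Set.Ico (-3 : ℝ) (-2)) (p : ENNReal)
    (hp : ENNReal.ofReal (3 / (3 + γ + 2)) < p) (θ : ℝ)
    (hθ : 2 + 3 * (1 - p⁻¹.toReal) < θ) :
    ∃ C > (0 : ℝ), ∀ f : V3 → ℝ, Measurable f →
      eLpNorm (fun v => jap v ^ θ * f v) p volume < ⊤ →
      ∀ v : V3,
        (∀ i j : Fin 3, Integrable (fun w : V3 => aker γ (v - w) i j * f w)) ∧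
        |∑ i, ∑ j, conv3 (fun z => aker γ z i j) f v * v i * v j|
          ≤ C * jap v ^ (γ + 2) * (eLpNorm (fun v => jap v ^ θ * f v) p volume).toReal ∧
        (∀ i : Fin 3, |∑ j, conv3 (fun z => aker γ z i j) f v * v j|
          ≤ C * jap v ^ (γ + 2) * (eLpNorm (fun v => jap v ^ θ * f v) p volume).toReal) ∧
        (∀ i j : Fin 3, |conv3 (fun z => aker γ z i j) f v|
          ≤ C * jap v ^ (γ + 2) * (eLpNorm (fun v => jap v ^ θ * f v) p volume).toReal) := by
  obtain ⟨hγ1, hγ2⟩ := hγ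
  have hpos : 0 < 3 / (3 + γ + 2) := by
    apply div_pos <;> linarith
  have hp1 : 1 < p := by
    refine lt_of_le_of_lt ?_ hp
    rw [ENNReal.one_le_ofReal, one_le_div (by linarith)]
    linarith
  have hpi : p⁻¹.toReal < (3 + γ + 2) / 3 := by
    have h := ENNReal.inv_lt_inv.2 hp
    rw [← ENNReal.ofReal_inv_of_pos hpos, inv_div] at h
    exact (ENNReal.lt_ofReal_iff_toReal_lt h.ne_top).1 h
  obtain ⟨C, hC, hCf⟩ := exists_integral_norm_rpow_neg_mul_jap_sq_mul_abs_le
    (s := -(γ + 2)) (θ := θ) (p := p) (by linarith) hp1 (by linarith) hθ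
  simp only [neg_neg] at hCf
  refine ⟨18 * C, by positivity, fun f hf hfin v => ?_⟩
  obtain ⟨hGi, hGle⟩ := hCf f hf hfin v
  set N := (eLpNorm (fun v => jap v ^ θ * f v) p volume).toReal
  set G : V3 → ℝ := fun w => ‖v - w‖ ^ (γ + 2) * jap w ^ 2 * |f w| with hG
  have hG0 : ∀ w, 0 ≤ G w := fun w => by positivity
  have key : ∀ K : V3 → ℝ, (∀ w, |K w| ≤ 18 * G w) →
      |∫ w, K w| ≤ 18 * C * jap v ^ (γ + 2) * N := fun K hK => by
    calc |∫ w, K w| = ‖∫ w, K w‖ := (Real.norm_eq_abs _).symm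
      _ ≤ ∫ w, 18 * G w := norm_integral_le_of_norm_le (hGi.const_mul 18) (Eventually.of_forall hK)
      _ = 18 * ∫ w, G w := integral_const_mul _ _
      _ ≤ 18 * (C * jap v ^ (γ + 2) * N) := by gcongr
      _ = _ := by ring
  have hterm : ∀ (w : V3) (i j : Fin 3) (c : ℝ), |c| ≤ jap w ^ 2 →
      |aker γ (v - w) i j * c * f w| ≤ 2 * G w := fun w i j c hc => by
    rw [abs_mul, abs_mul]
    calc |aker γ (v - w) i j| * |c| * |f w|
        ≤ 2 * ‖v - w‖ ^ (γ + 2) * jap w ^ 2 * |f w| := by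
          gcongr
          exact abs_aker_le γ (v - w) i j
      _ = 2 * G w := by rw [hG]; ring
  have happ : ∀ (w : V3) (i : Fin 3), |w i| ≤ jap w := fun w i =>
    (abs_apply_le_norm w i).trans (norm_le_jap w)
  have hc1 : ∀ w : V3, |(1 : ℝ)| ≤ jap w ^ 2 := fun w => by
    rw [abs_one]
    exact one_le_pow₀ (one_le_jap w)
  have hc2 : ∀ (w : V3) (i : Fin 3), |w i| ≤ jap w ^ 2 := fun w i =>
    (happ w i).trans (le_self_pow₀ (one_le_jap w) two_ne_zero)
  have hc3 : ∀ (w : V3) (i j : Fin 3), |w i * w j| ≤ jap w ^ 2 := fun w i j => by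
    rw [abs_mul, sq]
    exact mul_le_mul (happ w i) (happ w j) (abs_nonneg _) (jap_pos w).le
  have hint : ∀ i j : Fin 3, Integrable (fun w : V3 => aker γ (v - w) i j * f w) := fun i j => by
    refine (hGi.const_mul 2).mono' ?_ (Eventually.of_forall fun w => ?_)
    · refine Measurable.aestronglyMeasurable ?_
      unfold aker
      fun_prop
    · simpa using hterm w i j 1 (hc1 w)
  have hrow : ∀ i, ∑ j, conv3 (fun z => aker γ z i j) f v * v j =
      ∫ w, ∑ j, aker γ (v - w) i j * w j * f w := fun i => by
    simp only [conv3, ← integral_mul_const]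
    rw [← integral_finsetSum _ fun j _ => (hint i j).mul_const _]
    refine integral_congr_ae (Eventually.of_forall fun w => ?_)
    beta_reduce
    rw [← Finset.sum_mul, ← sum_aker_sub_mul γ v w i, Finset.sum_mul]
    exact Finset.sum_congr rfl fun j _ => by ring
  have hquad : ∑ i, ∑ j, conv3 (fun z => aker γ z i j) f v * v i * v j =
      ∫ w, ∑ i, ∑ j, aker γ (v - w) i j * (w i * w j) * f w := by
    simp only [conv3, ← integral_mul_const]
    have hi : ∀ i j, Integrable (fun w => aker γ (v - w) i j * f w * v i * v j) := fun i j =>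
      ((hint i j).mul_const _).mul_const _
    simp only [← integral_finsetSum _ fun j _ => hi _ j]
    rw [← integral_finsetSum _ fun i _ => integrable_finsetSum _ fun j _ => hi i j]
    refine integral_congr_ae (Eventually.of_forall fun w => ?_)
    simp only [← Finset.sum_mul, ← mul_assoc]
    rw [← sum_sum_aker_sub_mul_mul γ v w]
    simp only [Finset.sum_mul]
    exact Finset.sum_congr rfl fun i _ => Finset.sum_congr rfl fun j _ => by ring
  refine ⟨hint, ?_, fun i => ?_, fun i j => ?_⟩
  · rw [hquad]
    refine key _ fun w => ?_
    calc |∑ i, ∑ j, aker γ (v - w) i j * (w i * w j) * f w|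
        ≤ ∑ i, ∑ j, |aker γ (v - w) i j * (w i * w j) * f w| :=
          (Finset.abs_sum_le_sum_abs _ _).trans
            (Finset.sum_le_sum fun i _ => Finset.abs_sum_le_sum_abs _ _)
      _ ≤ ∑ _i : Fin 3, ∑ _j : Fin 3, 2 * G w :=
          Finset.sum_le_sum fun i _ => Finset.sum_le_sum fun j _ => hterm w i j _ (hc3 w i j)
      _ = 18 * G w := by
          simp
          ring
  · rw [hrow]
    refine key _ fun w => ?_
    calc |∑ j, aker γ (v - w) i j * w j * f w|
        ≤ ∑ j, |aker γ (v - w) i j * w j * f w| := Finset.abs_sum_le_sum_abs _ _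
      _ ≤ ∑ _j : Fin 3, 2 * G w := Finset.sum_le_sum fun j _ => hterm w i j _ (hc2 w j)
      _ ≤ 18 * G w := by
          simp
          linarith [hG0 w]
  · refine key _ fun w => ?_
    have h := hterm w i j 1 (hc1 w)
    rw [mul_one] at h
    linarith [hG0 w]
end
end

section
/- Let λ > 0, γ < 0, let k₀ < k₁ be real numbers and let k* ∈ (k₀, k₁). Then there exists a constant C > 0 such that for all t ≥ 0 one has inf_{R > 0} ( exp(−λ ⟨R⟩^γ t) + ⟨R⟩^{2(k₀−k₁)} ) ≤ C ⟨t⟩^{−2(k₁−k*)/|γ|}, where ⟨x⟩ = (1+x²)^{1/2}. -/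
noncomputable section

open Real

/-- Japanese bracket of a real number. -/
def japR (x : ℝ) : ℝ := Real.sqrt (1 + x ^ 2)

theorem one_le_japR (x : ℝ) : 1 ≤ japR x :=
  Real.one_le_sqrt.2 (by nlinarith [sq_nonneg x])

theorem japR_le_one_add {x : ℝ} (hx : 0 ≤ x) : japR x ≤ 1 + x :=
  Real.sqrt_le_iff.2 ⟨by linarith, by nlinarith⟩

/-- The Japanese bracket maps the positive reals onto the reals greater than one. -/
theorem exists_pos_japR_eq {s : ℝ} (hs : 1 < s) : ∃ R : ℝ, 0 < R ∧ japR R = s := by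
  have h : 0 < s ^ 2 - 1 := by nlinarith
  refine ⟨Real.sqrt (s ^ 2 - 1), Real.sqrt_pos.2 h, ?_⟩
  rw [japR, Real.sq_sqrt h.le, add_sub_cancel, Real.sqrt_sq (by linarith)]

/-- Exponential decay dominates polynomial decay, with an explicit constant. -/
theorem exp_neg_mul_le_rpow_neg {c s y : ℝ} (hc : 0 < c) (hs : 0 < s) (hy : 0 < y) :
    Real.exp (-(c * y)) ≤ (s / c) ^ s * y ^ (-s) := by
  have h₁ : y ≤ s / c * Real.exp (c * y / s) := by
    have h := (lt_add_one (c * y / s)).le.trans (Real.add_one_le_exp (c * y / s))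
    calc y = s / c * (c * y / s) := by field_simp
      _ ≤ _ := by gcongr
  have h₂ : y ^ s ≤ (s / c) ^ s * Real.exp (c * y) := by
    calc y ^ s ≤ (s / c * Real.exp (c * y / s)) ^ s := by gcongr
      _ = _ := by
        rw [Real.mul_rpow (by positivity) (by positivity), ← Real.exp_mul,
          div_mul_cancel₀ _ hs.ne']
  rw [Real.exp_neg, Real.rpow_neg hy.le, ← div_eq_mul_inv, le_div_iff₀ (by positivity),
    inv_mul_le_iff₀ (by positivity), mul_comm]
  exact h₂

/-- The quantitative decay estimate behind the polynomial-weight case of the semigroup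
decay: for λ > 0, γ < 0, k₀ < k* < k₁,
inf_{R>0} ( exp(−λ⟨R⟩^γ t) + ⟨R⟩^{2(k₀−k₁)} ) ≤ C ⟨t⟩^{−2(k₁−k*)/|γ|} for all t ≥ 0. -/
theorem stmt18 (lam γ k₀ k₁ kst : ℝ) (hlam : 0 < lam) (hγ : γ < 0)
    (hkst : kst ∈ Set.Ioo k₀ k₁) :
    ∃ C > (0 : ℝ), ∀ t : ℝ, 0 ≤ t →
      (⨅ R : {R : ℝ // 0 < R},
          (Real.exp (-lam * japR (R : ℝ) ^ γ * t) + japR (R : ℝ) ^ (2 * (k₀ - k₁))))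
        ≤ C * japR t ^ (-(2 * (k₁ - kst)) / |γ|) := by
  obtain ⟨h₀, h₁⟩ := hkst
  have ha : 0 < k₁ - k₀ := by linarith
  have hb : 0 < k₁ - kst := by linarith
  rw [abs_of_neg hγ]
  have hg : 0 < -γ := by linarith
  have hγ0 : γ ≠ 0 := hγ.ne
  obtain ⟨θ, hθ⟩ : ∃ θ, θ = (k₁ - kst) / (k₁ - k₀) := ⟨_, rfl⟩
  obtain ⟨p, hp⟩ : ∃ p, p = 2 * (k₁ - kst) / (-γ) := ⟨_, rfl⟩
  have hθ0 : 0 < θ := hθ ▸ div_pos hb ha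
  have hθ1 : 0 < 1 - θ := by
    rw [sub_pos, hθ, div_lt_one ha]
    linarith
  have hp0 : 0 < p := hp ▸ by positivity
  rw [neg_div, ← hp]
  obtain ⟨s, hs⟩ : ∃ s, s = p / (1 - θ) := ⟨_, rfl⟩
  have hs0 : 0 < s := hs ▸ div_pos hp0 hθ1
  refine ⟨Real.exp lam * (s / (lam / 2)) ^ s + 1, by positivity, fun t ht => ?_⟩
  have hT := one_le_japR t
  have hTt := japR_le_one_add ht
  obtain ⟨U, hU⟩ : ∃ U, U = 2 * japR t := ⟨_, rfl⟩
  have hU1 : 1 < U := by linarith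
  have hU0 : 0 < U := by linarith
  obtain ⟨R, hR, hRU⟩ := exists_pos_japR_eq (Real.one_lt_rpow hU1 (div_pos hθ0 hg))
  have hbdd : BddBelow (Set.range fun R : {R : ℝ // 0 < R} =>
      Real.exp (-lam * japR (R : ℝ) ^ γ * t) + japR (R : ℝ) ^ (2 * (k₀ - k₁))) := by
    refine ⟨0, ?_⟩
    rintro _ ⟨R, rfl⟩
    have := one_le_japR R
    positivity
  refine (ciInf_le hbdd ⟨R, hR⟩).trans ?_
  have hweight : (U ^ (θ / (-γ))) ^ (2 * (k₀ - k₁)) = U ^ (-p) := by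
    rw [← Real.rpow_mul hU0.le]
    congr 1
    rw [hθ, hp]
    field_simp
    ring
  have hrate : (U ^ (θ / (-γ))) ^ γ = U ^ (-θ) := by
    rw [← Real.rpow_mul hU0.le]
    congr 1
    field_simp
  have hsplit : U ^ (-θ) * U = U ^ (1 - θ) := by
    rw [← Real.rpow_add_one hU0.ne', neg_add_eq_sub]
  have hle : U ^ (-θ) ≤ 1 := Real.rpow_le_one_of_one_le_of_nonpos hU1.le (by linarith)
  have hUθ : 0 < U ^ (-θ) := by positivity
  have hexp : Real.exp (-lam * U ^ (-θ) * t)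
      ≤ Real.exp lam * (s / (lam / 2)) ^ s * U ^ (-p) := by
    calc Real.exp (-lam * U ^ (-θ) * t)
        ≤ Real.exp (lam + -(lam / 2 * U ^ (1 - θ))) := by
          gcongr
          have : U ^ (-θ) * (U / 2) ≤ 1 + U ^ (-θ) * t := by nlinarith
          rw [← hsplit]
          nlinarith
      _ ≤ Real.exp lam * ((s / (lam / 2)) ^ s * (U ^ (1 - θ)) ^ (-s)) := by
          rw [Real.exp_add]
          gcongr
          exact exp_neg_mul_le_rpow_neg (by positivity) hs0 (by positivity)
      _ = _ := by
          rw [← Real.rpow_mul hU0.le, ← mul_assoc, mul_neg, hs, mul_div_cancel₀ _ hθ1.ne']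
  have hUT : U ^ (-p) ≤ japR t ^ (-p) :=
    Real.rpow_le_rpow_of_nonpos (by linarith) (by linarith) (by linarith)
  simp only [hRU, hweight, hrate]
  calc _ ≤ (Real.exp lam * (s / (lam / 2)) ^ s + 1) * U ^ (-p) := by linarith
    _ ≤ _ := by gcongr
end
end
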